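/- arXiv:2511.10469 — 6 statements merged into one kernel-verified Lean document; each statement's English description precedes it below -/
import Mathlib

section
/- Let X be a graph of bounded degree and let 1 ≤ p ≤ q < ∞. Then for every real r ≥ 1, Λ^q_X(r) ≤ r^{1/p − 1/q} · Λ^p_X(r); in particular Λ^q_X(r) ≲ r^{1/p − 1/q} Λ^p_X(r). -/
open Finset

/-- The `ℓ^p` norm of a function on a finite vertex set:
`‖f‖_p = (∑ v, |f v|^p)^(1/p)`. -/
noncomputable def lpNorm {V : Type*} [Fintype V] (p : ℝ) (f : V → ℝ) : ℝ :=
  (∑ v, |f v| ^ p) ^ (1 / p)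

/-- The `ℓ^p` norm of the gradient of `f` on a finite simple graph:
`‖∇f‖_p = (∑ e ∈ E(Γ), |f x_e - f y_e|^p)^(1/p)`. -/
noncomputable def gradLpNorm {V : Type*} [Fintype V] (G : SimpleGraph V) (p : ℝ)
    (f : V → ℝ) : ℝ :=
  letI := Classical.decEq V
  letI := Classical.decRel G.Adj
  (∑ e ∈ G.edgeFinset,
    Sym2.lift ⟨fun x y => |f x - f y| ^ p,
      fun x y => by show |f x - f y| ^ p = |f y - f x| ^ p; rw [abs_sub_comm]⟩ e) ^ (1 / p)

/-- The `L^p`-Poincaré constant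
`h^p(Γ) = inf { ‖∇f‖_p / ‖f‖_p : f : V(Γ) → ℝ, ∑ v, f v = 0, f ≢ 0 }`
(equal to `0` by convention when the set is empty, e.g. when `|Γ| ≤ 1`). -/
noncomputable def poincareConst {V : Type*} [Fintype V] (G : SimpleGraph V) (p : ℝ) : ℝ :=
  sInf { c : ℝ | ∃ f : V → ℝ, (∑ v, f v) = 0 ∧ f ≠ 0 ∧ c = gradLpNorm G p f / lpNorm p f }

/-- The `L^p`-Poincaré profile
`Λ^p_X(r) = sup { |Γ| · h^p(Γ) : Γ a finite subgraph of X, |Γ| ≤ r }`.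
A finite subgraph is given by a finite set `s` of vertices together with a
simple graph structure on `s` whose adjacency relation is contained in that of `X`. -/
noncomputable def poincareProfile {V : Type*} (X : SimpleGraph V) (p : ℝ) (r : ℝ) : ℝ :=
  sSup { c : ℝ | ∃ (s : Finset V) (G : SimpleGraph s),
    (∀ u v : s, G.Adj u v → X.Adj u v) ∧ (s.card : ℝ) ≤ r ∧
    c = (s.card : ℝ) * poincareConst G p }

theorem aux_lp_mono {ι : Type*} (s : Finset ι) (a : ι → ℝ) (ha : ∀ i ∈ s, 0 ≤ a i)
    (p q : ℝ) (hp : 1 ≤ p) (hpq : p ≤ q) :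
    (∑ i ∈ s, a i ^ q) ^ (1 / q) ≤ (∑ i ∈ s, a i ^ p) ^ (1 / p) := by
  have hp0 : 0 < p := by linarith
  have hq0 : 0 < q := by linarith
  set S := ∑ i ∈ s, a i ^ p with hS
  have hS0 : 0 ≤ S := Finset.sum_nonneg fun i hi => Real.rpow_nonneg (ha i hi) _
  have h1 : ∀ i ∈ s, a i ≤ S ^ (1 / p) := by
    intro i hi
    have h : a i ^ p ≤ S :=
      Finset.single_le_sum (f := fun i => a i ^ p)
        (fun j hj => Real.rpow_nonneg (ha j hj) _) hi
    calc a i = (a i ^ p) ^ (1 / p) := by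
          rw [← Real.rpow_mul (ha i hi), mul_one_div_cancel hp0.ne', Real.rpow_one]
      _ ≤ S ^ (1 / p) := Real.rpow_le_rpow (Real.rpow_nonneg (ha i hi) _) h (by positivity)
  have h2 : ∑ i ∈ s, a i ^ q ≤ S ^ (q / p) := by
    calc ∑ i ∈ s, a i ^ q ≤ ∑ i ∈ s, a i ^ p * (S ^ (1 / p)) ^ (q - p) := by
          apply Finset.sum_le_sum
          intro i hi
          have : a i ^ q = a i ^ p * a i ^ (q - p) := by
            rw [← Real.rpow_add_of_nonneg (ha i hi) hp0.le (by linarith)]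
            congr 1; ring
          rw [this]
          exact mul_le_mul_of_nonneg_left
            (Real.rpow_le_rpow (ha i hi) (h1 i hi) (by linarith)) (Real.rpow_nonneg (ha i hi) _)
      _ = S ^ (1 : ℝ) * S ^ ((q - p) / p) := by
          rw [← Finset.sum_mul, ← Real.rpow_mul hS0, Real.rpow_one]
          congr 2; ring
      _ = S ^ (q / p) := by
          rw [← Real.rpow_add_of_nonneg hS0 zero_le_one (div_nonneg (by linarith) hp0.le)]
          congr 1; field_simp; ring
  calc (∑ i ∈ s, a i ^ q) ^ (1 / q) ≤ (S ^ (q / p)) ^ (1 / q) :=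
        Real.rpow_le_rpow (Finset.sum_nonneg fun i hi => Real.rpow_nonneg (ha i hi) _) h2
          (by positivity)
    _ = S ^ (1 / p) := by
        rw [← Real.rpow_mul hS0]; congr 1; field_simp

theorem aux_lp_holder {ι : Type*} (s : Finset ι) (a : ι → ℝ) (ha : ∀ i ∈ s, 0 ≤ a i)
    (p q : ℝ) (hp : 1 ≤ p) (hpq : p ≤ q) :
    (∑ i ∈ s, a i ^ p) ^ (1 / p) ≤
      (s.card : ℝ) ^ (1 / p - 1 / q) * (∑ i ∈ s, a i ^ q) ^ (1 / q) := by
  have hp0 : 0 < p := by linarith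
  have hq0 : 0 < q := by linarith
  have hS0 : 0 ≤ ∑ i ∈ s, a i ^ p := Finset.sum_nonneg fun i hi => Real.rpow_nonneg (ha i hi) _
  have hT0 : 0 ≤ ∑ i ∈ s, a i ^ q := Finset.sum_nonneg fun i hi => Real.rpow_nonneg (ha i hi) _
  have h := Real.rpow_sum_le_const_mul_sum_rpow s (fun i => a i ^ p)
    (p := q / p) ((one_le_div hp0).2 hpq)
  have e1 : ∑ i ∈ s, |a i ^ p| = ∑ i ∈ s, a i ^ p :=
    Finset.sum_congr rfl fun i hi => abs_of_nonneg (Real.rpow_nonneg (ha i hi) _)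
  have e2 : ∑ i ∈ s, |a i ^ p| ^ (q / p) = ∑ i ∈ s, a i ^ q :=
    Finset.sum_congr rfl fun i hi => by
      rw [abs_of_nonneg (Real.rpow_nonneg (ha i hi) _), ← Real.rpow_mul (ha i hi)]
      congr 1; field_simp
  rw [e1, e2] at h
  have h3 := Real.rpow_le_rpow (Real.rpow_nonneg hS0 _) h (z := 1 / q) (by positivity)
  rw [Real.mul_rpow (by positivity) hT0, ← Real.rpow_mul hS0, ← Real.rpow_mul (by positivity)] at h3
  convert h3 using 2
  · field_simp
  · congr 1; field_simp

noncomputable def auxGrad {V : Type*} (f : V → ℝ) : Sym2 V → ℝ :=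
  Sym2.lift ⟨fun x y => |f x - f y|, fun x y => abs_sub_comm _ _⟩

theorem auxGrad_nonneg {V : Type*} (f : V → ℝ) (e : Sym2 V) : 0 ≤ auxGrad f e := by
  induction e with
  | _ x y => simp [auxGrad]

theorem aux_grad_eq {V : Type*} [Fintype V] (G : SimpleGraph V) :
    ∃ s : Finset (Sym2 V), s.card ≤ (Fintype.card V) ^ 2 ∧ ∀ (p : ℝ) (f : V → ℝ),
      gradLpNorm G p f = (∑ e ∈ s, auxGrad f e ^ p) ^ (1 / p) := by
  classical
  letI := Classical.decEq V
  letI := Classical.decRel G.Adj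
  refine ⟨G.edgeFinset, ?_, ?_⟩
  · exact G.card_edgeFinset_le_card_choose_two.trans (Nat.choose_le_pow _ _)
  · intro p f
    unfold gradLpNorm
    congr 1
    apply Finset.sum_congr
    · congr
    · intro e _
      induction e with
      | _ x y => simp [auxGrad]

theorem aux_abs_le {V : Type*} [Fintype V] (p : ℝ) (hp : 1 ≤ p) (f : V → ℝ) (v : V) :
    |f v| ≤ lpNorm p f := by
  have hp0 : 0 < p := by linarith
  have h : |f v| ^ p ≤ ∑ v, |f v| ^ p :=
    Finset.single_le_sum (f := fun i => |f i| ^ p)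
      (fun j _ => Real.rpow_nonneg (abs_nonneg _) _) (Finset.mem_univ v)
  calc |f v| = (|f v| ^ p) ^ (1 / p) := by
        rw [← Real.rpow_mul (abs_nonneg _), mul_one_div_cancel hp0.ne', Real.rpow_one]
    _ ≤ _ := Real.rpow_le_rpow (Real.rpow_nonneg (abs_nonneg _) _) h (by positivity)

theorem aux_lpNorm_pos {V : Type*} [Fintype V] (p : ℝ) (hp : 1 ≤ p) (f : V → ℝ) (hf : f ≠ 0) :
    0 < lpNorm p f := by
  obtain ⟨v, hv⟩ := Function.ne_iff.1 hf
  exact lt_of_lt_of_le (abs_pos.2 hv) (aux_abs_le p hp f v)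

theorem aux_grad_nonneg {V : Type*} [Fintype V] (G : SimpleGraph V) (p : ℝ) (f : V → ℝ) :
    0 ≤ gradLpNorm G p f := by
  obtain ⟨s, -, h⟩ := aux_grad_eq G
  rw [h]
  exact Real.rpow_nonneg (Finset.sum_nonneg fun e _ => Real.rpow_nonneg (auxGrad_nonneg f e) _) _

theorem aux_ratio_nonneg {V : Type*} [Fintype V] (G : SimpleGraph V) (p : ℝ) (hp : 1 ≤ p)
    (f : V → ℝ) (hf : f ≠ 0) : 0 ≤ gradLpNorm G p f / lpNorm p f :=
  div_nonneg (aux_grad_nonneg G p f) (aux_lpNorm_pos p hp f hf).le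

theorem aux_const_nonneg {V : Type*} [Fintype V] (G : SimpleGraph V) (p : ℝ) (hp : 1 ≤ p) :
    0 ≤ poincareConst G p := by
  apply Real.sInf_nonneg
  rintro c ⟨f, -, hf, rfl⟩
  exact aux_ratio_nonneg G p hp f hf

theorem aux_const_le {V : Type*} [Fintype V] (G : SimpleGraph V) (p : ℝ) (hp : 1 ≤ p)
    (f : V → ℝ) (h0 : ∑ v, f v = 0) (hf : f ≠ 0) :
    poincareConst G p ≤ gradLpNorm G p f / lpNorm p f := by
  apply csInf_le
  · refine ⟨0, ?_⟩
    rintro c ⟨f, -, hf, rfl⟩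
    exact aux_ratio_nonneg G p hp f hf
  · exact ⟨f, h0, hf, rfl⟩

theorem aux_grad_le {V : Type*} [Fintype V] (G : SimpleGraph V) (p : ℝ) (hp : 1 ≤ p)
    (f : V → ℝ) :
    gradLpNorm G p f ≤ ((Fintype.card V : ℝ) ^ 2) ^ (1 / p) * (2 * lpNorm p f) := by
  have hp0 : 0 < p := by linarith
  obtain ⟨s, hs, h⟩ := aux_grad_eq G
  rw [h]
  have hL : 0 ≤ lpNorm p f :=
    Real.rpow_nonneg (Finset.sum_nonneg fun e _ => Real.rpow_nonneg (abs_nonneg _) _) _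
  have hb : ∀ e, auxGrad f e ≤ 2 * lpNorm p f := by
    intro e
    induction e with
    | _ x y =>
      have := abs_sub (f x) (f y)
      have h1 := aux_abs_le p hp f x
      have h2 := aux_abs_le p hp f y
      simp only [auxGrad, Sym2.lift_mk]
      linarith
  have hsum : ∑ e ∈ s, auxGrad f e ^ p ≤ (Fintype.card V : ℝ) ^ 2 * (2 * lpNorm p f) ^ p := by
    calc ∑ e ∈ s, auxGrad f e ^ p ≤ ∑ e ∈ s, (2 * lpNorm p f) ^ p :=
          Finset.sum_le_sum fun e _ => Real.rpow_le_rpow (auxGrad_nonneg f e) (hb e) hp0.le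
      _ = (s.card : ℝ) * (2 * lpNorm p f) ^ p := by rw [Finset.sum_const, nsmul_eq_mul]
      _ ≤ _ := by
          gcongr
          exact_mod_cast hs
  refine (Real.rpow_le_rpow (Finset.sum_nonneg fun e _ => Real.rpow_nonneg (auxGrad_nonneg f e) _)
    hsum (by positivity : 0 ≤ 1 / p)).trans_eq ?_
  rw [Real.mul_rpow (by positivity) (by positivity), ← Real.rpow_mul (by positivity : 0 ≤ 2 * lpNorm p f),
    mul_one_div_cancel hp0.ne', Real.rpow_one]

theorem aux_const_bdd {V : Type*} [Fintype V] (G : SimpleGraph V) (p : ℝ) (hp : 1 ≤ p) :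
    poincareConst G p ≤ ((Fintype.card V : ℝ) ^ 2) ^ (1 / p) * 2 := by
  by_cases h : ∃ f : V → ℝ, ∑ v, f v = 0 ∧ f ≠ 0
  · obtain ⟨f, h0, hf⟩ := h
    refine (aux_const_le G p hp f h0 hf).trans ?_
    rw [div_le_iff₀ (aux_lpNorm_pos p hp f hf), mul_assoc]
    exact aux_grad_le G p hp f
  · have : {c : ℝ | ∃ f : V → ℝ, (∑ v, f v) = 0 ∧ f ≠ 0 ∧
        c = gradLpNorm G p f / lpNorm p f} = ∅ := by
      ext c
      simp only [Set.mem_setOf_eq, Set.mem_empty_iff_false, iff_false]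
      rintro ⟨f, h0, hf, -⟩
      exact h ⟨f, h0, hf⟩
    unfold poincareConst
    rw [this, Real.sInf_empty]
    positivity

theorem aux_const_compare {V : Type*} [Fintype V] (G : SimpleGraph V) (p q : ℝ) (hp : 1 ≤ p)
    (hpq : p ≤ q) :
    poincareConst G q ≤ (Fintype.card V : ℝ) ^ (1 / p - 1 / q) * poincareConst G p := by
  have hq : 1 ≤ q := hp.trans hpq
  by_cases h : ∃ f : V → ℝ, ∑ v, f v = 0 ∧ f ≠ 0
  · obtain ⟨f₀, h0, hf0⟩ := h
    have hcard : 0 < (Fintype.card V : ℝ) := by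
      obtain ⟨v, -⟩ := Function.ne_iff.1 hf0
      exact_mod_cast Fintype.card_pos_iff.2 ⟨v⟩
    have hC : 0 < (Fintype.card V : ℝ) ^ (1 / p - 1 / q) := Real.rpow_pos_of_pos hcard _
    rw [← div_le_iff₀' hC]
    refine le_csInf (s := {c : ℝ | ∃ f : V → ℝ, (∑ v, f v) = 0 ∧ f ≠ 0 ∧
        c = gradLpNorm G p f / lpNorm p f}) ⟨_, f₀, h0, hf0, rfl⟩ ?_
    rintro c ⟨f, h0, hf, rfl⟩
    rw [div_le_iff₀' hC]
    refine (aux_const_le G q hq f h0 hf).trans ?_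
    have hP := aux_lpNorm_pos p hp f hf
    have hQ := aux_lpNorm_pos q hq f hf
    have hg : gradLpNorm G q f ≤ gradLpNorm G p f := by
      obtain ⟨s, -, h⟩ := aux_grad_eq G
      rw [h, h]
      exact aux_lp_mono s _ (fun e _ => auxGrad_nonneg f e) p q hp hpq
    have hn : lpNorm p f ≤ (Fintype.card V : ℝ) ^ (1 / p - 1 / q) * lpNorm q f :=
      aux_lp_holder Finset.univ (fun v => |f v|) (fun _ _ => abs_nonneg _) p q hp hpq
    rw [← mul_div_assoc, div_le_div_iff₀ hQ hP]
    calc gradLpNorm G q f * lpNorm p f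
        ≤ gradLpNorm G p f * ((Fintype.card V : ℝ) ^ (1 / p - 1 / q) * lpNorm q f) :=
          mul_le_mul hg hn hP.le (aux_grad_nonneg G p f)
      _ = _ := by ring
  · have : {c : ℝ | ∃ f : V → ℝ, (∑ v, f v) = 0 ∧ f ≠ 0 ∧
        c = gradLpNorm G q f / lpNorm q f} = ∅ := by
      ext c
      simp only [Set.mem_setOf_eq, Set.mem_empty_iff_false, iff_false]
      rintro ⟨f, h0, hf, -⟩
      exact h ⟨f, h0, hf⟩
    have h2 : poincareConst G q = 0 := by
      unfold poincareConst
      rw [this, Real.sInf_empty]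
    rw [h2]
    exact mul_nonneg (Real.rpow_nonneg (Nat.cast_nonneg _) _) (aux_const_nonneg G p hp)

/-- If `X` has bounded degree and `1 ≤ p ≤ q < ∞`, then for every `r ≥ 1`,
`Λ^q_X(r) ≤ r^(1/p - 1/q) * Λ^p_X(r)`; in particular `Λ^q_X(r) ≲ r^(1/p - 1/q) Λ^p_X(r)`. -/
theorem poincareProfile_le {V : Type*} (X : SimpleGraph V) (D : ℕ)
    (hdeg : ∀ v : V, {u : V | X.Adj v u}.Finite ∧ {u : V | X.Adj v u}.ncard ≤ D)
    (p q : ℝ) (hp : 1 ≤ p) (hpq : p ≤ q) :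
    ∀ r : ℝ, 1 ≤ r →
      poincareProfile X q r ≤ r ^ (1 / p - 1 / q) * poincareProfile X p r := by
  intro r hr
  have hr0 : 0 ≤ r := by linarith
  have hp0 : 0 < p := by linarith
  have hexp : 0 ≤ 1 / p - 1 / q := sub_nonneg.2 (one_div_le_one_div_of_le hp0 hpq)
  apply csSup_le
  · exact ⟨_, ∅, ⊥, by simp, by simpa using hr0, rfl⟩
  rintro c ⟨s, G, hG, hs, rfl⟩
  have hle : (s.card : ℝ) * poincareConst G p ≤ poincareProfile X p r := by
    apply le_csSup
    · refine ⟨r * ((r ^ 2) ^ (1 / p) * 2), ?_⟩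
      rintro c ⟨t, H, -, ht, rfl⟩
      have hb := aux_const_bdd H p hp
      rw [Fintype.card_coe] at hb
      refine mul_le_mul ht (hb.trans ?_) (aux_const_nonneg H p hp) hr0
      gcongr
    · exact ⟨s, G, hG, hs, rfl⟩
  have hc := aux_const_compare G p q hp hpq
  rw [Fintype.card_coe] at hc
  have hn := aux_const_nonneg G p hp
  calc (s.card : ℝ) * poincareConst G q
      ≤ (s.card : ℝ) * ((s.card : ℝ) ^ (1 / p - 1 / q) * poincareConst G p) := by gcongr
    _ = (s.card : ℝ) ^ (1 / p - 1 / q) * ((s.card : ℝ) * poincareConst G p) := by ring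
    _ ≤ r ^ (1 / p - 1 / q) * ((s.card : ℝ) * poincareConst G p) := by gcongr
    _ ≤ r ^ (1 / p - 1 / q) * poincareProfile X p r := by gcongr
end

section
/- Let X be a graph of bounded degree and let 1 ≤ p ≤ q < ∞. If there exists C > 0 such that Λ^p_X(r) ≤ C·(Cr + C)^{1 − 1/p} + C for all r ≥ 1, then there exists C' > 0 such that Λ^q_X(r) ≤ C'·(C'r + C')^{1 − 1/q} + C' for all r ≥ 1. In other words, the set { p ∈ [1,∞) : Λ^p_X(r) ≲ r^{1−1/p} } is upward closed in [1,∞), and hence is an interval of the form (p_Λ(X), ∞), [p_Λ(X), ∞), or ∅, where p_Λ(X) = inf{ p ≥ 1 : Λ^p_X(r) ≲ r^{1−1/p} }. -/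
open Finset

lemma add_rpow_le_aux (x y : ℝ) {p : ℝ} (hx : 0 ≤ x) (hy : 0 ≤ y) (hp : 1 ≤ p) :
    (x + y) ^ p ≤ 2 ^ (p - 1) * (x ^ p + y ^ p) := by
  lift x to NNReal using hx
  lift y to NNReal using hy
  exact_mod_cast NNReal.rpow_add_le_mul_rpow_add_rpow x y hp

/-- Signed power function. -/
noncomputable def sgnPow (a x : ℝ) : ℝ := (max x 0) ^ a - (max (-x) 0) ^ a

lemma sgnPow_abs (a x : ℝ) (ha : 0 < a) : |sgnPow a x| = |x| ^ a := by
  unfold sgnPow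
  rcases le_total 0 x with h | h
  · rw [max_eq_left h, max_eq_right (by linarith), Real.zero_rpow ha.ne', sub_zero,
      abs_of_nonneg h, abs_of_nonneg (Real.rpow_nonneg h a)]
  · rw [max_eq_right h, max_eq_left (by linarith), Real.zero_rpow ha.ne', zero_sub, abs_neg,
      abs_of_nonpos h, abs_of_nonneg (Real.rpow_nonneg (by linarith) a)]

lemma rpow_sub_le_aux (a x y : ℝ) (ha : 0 < a) (ha1 : a ≤ 1) (hx : 0 ≤ x) (hy : 0 ≤ y) :
    |x ^ a - y ^ a| ≤ |x - y| ^ a := by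
  wlog hxy : y ≤ x generalizing x y
  · rw [abs_sub_comm, abs_sub_comm x y]
    exact this y x hy hx (le_of_not_ge hxy)
  have h1 : y ^ a ≤ x ^ a := Real.rpow_le_rpow hy hxy ha.le
  rw [abs_of_nonneg (by linarith), abs_of_nonneg (by linarith)]
  have := Real.rpow_add_le_add_rpow (sub_nonneg.2 hxy) hy ha.le ha1
  rw [sub_add_cancel] at this
  linarith

lemma sgnPow_sub (a x y : ℝ) (ha : 0 < a) (ha1 : a ≤ 1) :
    |sgnPow a x - sgnPow a y| ≤ 2 * |x - y| ^ a := by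
  have h1 : |(max x 0) ^ a - (max y 0) ^ a| ≤ |x - y| ^ a :=
    (rpow_sub_le_aux a _ _ ha ha1 (le_max_right _ _) (le_max_right _ _)).trans
      (Real.rpow_le_rpow (abs_nonneg _) (abs_max_sub_max_le_abs x y 0) ha.le)
  have h2 : |(max (-x) 0) ^ a - (max (-y) 0) ^ a| ≤ |x - y| ^ a := by
    refine (rpow_sub_le_aux a _ _ ha ha1 (le_max_right _ _) (le_max_right _ _)).trans
      (Real.rpow_le_rpow (abs_nonneg _) ?_ ha.le)
    refine (abs_max_sub_max_le_abs (-x) (-y) 0).trans ?_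
    rw [abs_sub_comm x y]
    apply le_of_eq
    congr 1
    ring
  unfold sgnPow
  rw [abs_le] at *
  constructor <;> linarith [h1.1, h1.2, h2.1, h2.2]

lemma sgnPow_continuous (a : ℝ) (ha : 0 < a) : Continuous (sgnPow a) := by
  unfold sgnPow
  refine Continuous.sub ?_ ?_
  · exact (continuous_id.max continuous_const).rpow_const (fun _ => Or.inr ha.le)
  · exact (continuous_neg.max continuous_const).rpow_const (fun _ => Or.inr ha.le)

lemma sgnPow_nonneg (a x : ℝ) (ha : 0 < a) (h : 0 ≤ x) : 0 ≤ sgnPow a x := by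
  unfold sgnPow
  rw [max_eq_left h, max_eq_right (by linarith), Real.zero_rpow ha.ne', sub_zero]
  exact Real.rpow_nonneg h a

lemma sgnPow_nonpos (a x : ℝ) (ha : 0 < a) (h : x ≤ 0) : sgnPow a x ≤ 0 := by
  unfold sgnPow
  rw [max_eq_right h, max_eq_left (by linarith), Real.zero_rpow ha.ne', zero_sub]
  linarith [Real.rpow_nonneg (by linarith : 0 ≤ -x) a]

lemma exists_shift {V : Type*} [Fintype V] (a : ℝ) (ha : 0 < a) (f : V → ℝ) :
    ∃ t : ℝ, ∑ v, sgnPow a (f v - t) = 0 := by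
  have hc : Continuous (fun t : ℝ => ∑ v, sgnPow a (f v - t)) :=
    continuous_finsetSum _ fun v _ =>
      (sgnPow_continuous a ha).comp (continuous_const.sub continuous_id)
  have hb : ∀ v, |f v| ≤ ∑ w, |f w| := fun v =>
    Finset.single_le_sum (f := fun w => |f w|) (fun w _ => abs_nonneg _) (Finset.mem_univ v)
  have := mem_range_of_exists_le_of_exists_ge (c := (0 : ℝ)) hc
    ⟨∑ w, |f w|, Finset.sum_nonpos fun v _ => sgnPow_nonpos a _ ha
      (by linarith [hb v, le_abs_self (f v)])⟩
    ⟨-∑ w, |f w|, Finset.sum_nonneg fun v _ => sgnPow_nonneg a _ ha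
      (by linarith [hb v, neg_abs_le (f v)])⟩
  exact this

lemma shift_norm {V : Type*} [Fintype V] (p : ℝ) (hp : 1 ≤ p) (f : V → ℝ) (hf : ∑ v, f v = 0)
    (t : ℝ) : ∑ v, |f v| ^ p ≤ 2 ^ p * ∑ v, |f v - t| ^ p := by
  rcases isEmpty_or_nonempty V with hV | hV
  · simp
  have hn : (0 : ℝ) < Fintype.card V := by exact_mod_cast Fintype.card_pos
  have hJ := Real.rpow_arith_mean_le_arith_mean_rpow Finset.univ
    (fun _ : V => (1 : ℝ) / Fintype.card V) (fun v => |f v - t|)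
    (fun _ _ => by positivity) (by simp) (fun _ _ => abs_nonneg _) hp
  simp only [← Finset.mul_sum] at hJ
  have ht : |t| ≤ 1 / Fintype.card V * ∑ v, |f v - t| := by
    have h1 : |∑ v, (f v - t)| ≤ ∑ v, |f v - t| := Finset.abs_sum_le_sum_abs _ _
    rw [Finset.sum_sub_distrib, hf] at h1
    simp only [Finset.sum_const, Finset.card_univ, nsmul_eq_mul, zero_sub, abs_neg, abs_mul,
      Nat.abs_cast] at h1
    rw [one_div, le_inv_mul_iff₀ hn]
    exact h1
  have ht2 : (Fintype.card V : ℝ) * |t| ^ p ≤ ∑ v, |f v - t| ^ p := by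
    have := (Real.rpow_le_rpow (abs_nonneg _) ht (by linarith)).trans hJ
    rwa [one_div, le_inv_mul_iff₀ hn] at this
  have hv : ∀ v, |f v| ^ p ≤ 2 ^ (p - 1) * (|f v - t| ^ p + |t| ^ p) := fun v => by
    refine le_trans (Real.rpow_le_rpow (abs_nonneg _) ?_ (by linarith))
      (add_rpow_le_aux _ _ (abs_nonneg _) (abs_nonneg _) hp)
    have := abs_add_le (f v - t) t
    rwa [sub_add_cancel] at this
  calc ∑ v, |f v| ^ p ≤ ∑ v, 2 ^ (p - 1) * (|f v - t| ^ p + |t| ^ p) :=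
        Finset.sum_le_sum fun v _ => hv v
    _ = 2 ^ (p - 1) * (∑ v, |f v - t| ^ p + Fintype.card V * |t| ^ p) := by
        rw [← Finset.mul_sum, Finset.sum_add_distrib]; simp
    _ ≤ 2 ^ (p - 1) * (∑ v, |f v - t| ^ p + ∑ v, |f v - t| ^ p) := by gcongr
    _ = 2 ^ p * ∑ v, |f v - t| ^ p := by
        rw [← two_mul, ← mul_assoc, Real.rpow_sub_one (by norm_num)]
        congr 1
        ring

/-- Sum inside `gradLpNorm`. -/
noncomputable def gradSum {V : Type*} [Fintype V] (G : SimpleGraph V) (p : ℝ)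
    (f : V → ℝ) : ℝ :=
  letI := Classical.decEq V
  letI := Classical.decRel G.Adj
  (∑ e ∈ G.edgeFinset,
    Sym2.lift ⟨fun x y => |f x - f y| ^ p,
      fun x y => by show |f x - f y| ^ p = |f y - f x| ^ p; rw [abs_sub_comm]⟩ e)

lemma gradLpNorm_eq {V : Type*} [Fintype V] (G : SimpleGraph V) (p : ℝ) (f : V → ℝ) :
    gradLpNorm G p f = (gradSum G p f) ^ (1 / p) := rfl

lemma gradSum_nonneg {V : Type*} [Fintype V] (G : SimpleGraph V) (p : ℝ) (f : V → ℝ) :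
    0 ≤ gradSum G p f := by
  classical
  unfold gradSum
  refine Finset.sum_nonneg fun e _ => ?_
  induction e using Sym2.ind with
  | _ x y => exact Real.rpow_nonneg (abs_nonneg _) _

lemma gradSum_le_of_le {V : Type*} [Fintype V] (G : SimpleGraph V) (p q K : ℝ) (f g : V → ℝ)
    (h : ∀ x y, |g x - g y| ^ q ≤ K * |f x - f y| ^ p) :
    gradSum G q g ≤ K * gradSum G p f := by
  classical
  unfold gradSum
  rw [Finset.mul_sum]
  refine Finset.sum_le_sum fun e _ => ?_
  induction e using Sym2.ind with
  | _ x y => exact h x y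

lemma gradSum_le_card {V : Type*} [Fintype V] (G : SimpleGraph V) (p K : ℝ) (hK : 0 ≤ K)
    (f : V → ℝ) (h : ∀ x y, |f x - f y| ^ p ≤ K) :
    gradSum G p f ≤ (Fintype.card V : ℝ) ^ 2 * K := by
  classical
  unfold gradSum
  refine (Finset.sum_le_card_nsmul _ _ K fun e _ => ?_).trans ?_
  · induction e using Sym2.ind with
    | _ x y => exact h x y
  · rw [nsmul_eq_mul]
    refine mul_le_mul_of_nonneg_right ?_ hK
    refine le_trans (Nat.cast_le.2 SimpleGraph.card_edgeFinset_le_card_choose_two) ?_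
    exact_mod_cast Nat.choose_le_pow _ _

lemma lpSum_pos {V : Type*} [Fintype V] (p : ℝ) (f : V → ℝ) (hf : f ≠ 0) :
    0 < ∑ v, |f v| ^ p := by
  obtain ⟨v, hv⟩ := Function.ne_iff.1 hf
  exact Finset.sum_pos' (fun w _ => Real.rpow_nonneg (abs_nonneg _) _)
    ⟨v, Finset.mem_univ v, Real.rpow_pos_of_pos (abs_pos.2 hv) _⟩

lemma ratio_nonneg {V : Type*} [Fintype V] (G : SimpleGraph V) (p : ℝ) (f : V → ℝ) :
    0 ≤ gradLpNorm G p f / lpNorm p f := by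
  rw [gradLpNorm_eq]
  refine div_nonneg (Real.rpow_nonneg (gradSum_nonneg _ _ _) _) (Real.rpow_nonneg ?_ _)
  exact Finset.sum_nonneg fun w _ => Real.rpow_nonneg (abs_nonneg _) _

lemma poincareConst_nonneg {V : Type*} [Fintype V] (G : SimpleGraph V) (p : ℝ) :
    0 ≤ poincareConst G p := by
  refine Real.sInf_nonneg ?_
  rintro c ⟨f, -, -, rfl⟩
  exact ratio_nonneg G p f

lemma poincareConst_le {V : Type*} [Fintype V] (G : SimpleGraph V) (p : ℝ) (f : V → ℝ)
    (h0 : ∑ v, f v = 0) (hf : f ≠ 0) :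
    poincareConst G p ≤ gradLpNorm G p f / lpNorm p f := by
  refine csInf_le ⟨0, ?_⟩ ⟨f, h0, hf, rfl⟩
  rintro c ⟨f, -, -, rfl⟩
  exact ratio_nonneg G p f

lemma ratio_eq {V : Type*} [Fintype V] (G : SimpleGraph V) (p : ℝ) (f : V → ℝ) :
    gradLpNorm G p f / lpNorm p f = (gradSum G p f / ∑ v, |f v| ^ p) ^ (1 / p) := by
  rw [gradLpNorm_eq, lpNorm, Real.div_rpow (gradSum_nonneg _ _ _)]
  exact Finset.sum_nonneg fun w _ => Real.rpow_nonneg (abs_nonneg _) _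

lemma poincareConst_bound {V : Type*} [Fintype V] (G : SimpleGraph V) (p : ℝ) (hp : 1 ≤ p) :
    poincareConst G p ≤ ((Fintype.card V : ℝ) ^ 2 * 2 ^ p) ^ (1 / p) := by
  by_cases hne : ∃ f : V → ℝ, (∑ v, f v) = 0 ∧ f ≠ 0
  · obtain ⟨f, h0, hf⟩ := hne
    refine (poincareConst_le G p f h0 hf).trans ?_
    rw [ratio_eq]
    have hS := lpSum_pos p f hf
    refine Real.rpow_le_rpow (div_nonneg (gradSum_nonneg _ _ _) hS.le) ?_ (by positivity)
    rw [div_le_iff₀ hS, mul_assoc]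
    refine gradSum_le_card G p _ (by positivity) f fun x y => ?_
    have hx : ∀ x, |f x| ^ p ≤ ∑ v, |f v| ^ p := fun x =>
      Finset.single_le_sum (f := fun w => |f w| ^ p)
        (fun w _ => Real.rpow_nonneg (abs_nonneg _) _) (Finset.mem_univ x)
    have h1 : |f x - f y| ≤ |f x| + |f y| := abs_sub _ _
    calc |f x - f y| ^ p ≤ (|f x| + |f y|) ^ p :=
          Real.rpow_le_rpow (abs_nonneg _) h1 (by linarith)
      _ ≤ 2 ^ (p - 1) * (|f x| ^ p + |f y| ^ p) :=
          add_rpow_le_aux _ _ (abs_nonneg _) (abs_nonneg _) hp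
      _ ≤ 2 ^ (p - 1) * (∑ v, |f v| ^ p + ∑ v, |f v| ^ p) := by
          gcongr
          · exact hx x
          · exact hx y
      _ = 2 ^ p * ∑ v, |f v| ^ p := by
        rw [← two_mul, ← mul_assoc, Real.rpow_sub_one (by norm_num)]
        congr 1
        ring
  · have : poincareConst G p = 0 := by
      unfold poincareConst
      convert Real.sInf_empty
      ext c
      simp only [Set.mem_setOf_eq, Set.mem_empty_iff_false, iff_false]
      rintro ⟨f, h0, hf, -⟩
      exact hne ⟨f, h0, hf⟩
    rw [this]
    positivity

/-- The key comparison. -/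
lemma poincareConst_compare {V : Type*} [Fintype V] (G : SimpleGraph V) (p q : ℝ) (hp : 1 ≤ p)
    (hpq : p ≤ q) : poincareConst G q ^ q ≤ 2 ^ q * 2 ^ p * poincareConst G p ^ p := by
  have hp0 : 0 < p := by linarith
  have hq0 : 0 < q := by linarith
  by_cases hne : ∃ f : V → ℝ, (∑ v, f v) = 0 ∧ f ≠ 0
  · have key : ∀ f : V → ℝ, (∑ v, f v) = 0 → f ≠ 0 →
        poincareConst G q ^ q ≤ 2 ^ q * 2 ^ p * (gradSum G p f / ∑ v, |f v| ^ p) := by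
      intro f h0 hf
      have ha : 0 < p / q := by positivity
      have ha1 : p / q ≤ 1 := (div_le_one hq0).2 hpq
      obtain ⟨t, ht⟩ := exists_shift (p / q) ha f
      have hS := lpSum_pos p f hf
      have hsh := shift_norm p hp f h0 t
      have hg : ∀ v, |sgnPow (p / q) (f v - t)| ^ q = |f v - t| ^ p := fun v => by
        rw [sgnPow_abs _ _ ha, ← Real.rpow_mul (abs_nonneg _), div_mul_cancel₀ _ hq0.ne']
      have hT : 0 < ∑ v, |f v - t| ^ p := by
        by_contra hcon
        have : (2 : ℝ) ^ p * ∑ v, |f v - t| ^ p ≤ 0 :=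
          mul_nonpos_of_nonneg_of_nonpos (by positivity) (not_lt.1 hcon)
        linarith
      have hg0 : (fun v => sgnPow (p / q) (f v - t)) ≠ 0 := by
        intro hz
        have : ∑ v, |f v - t| ^ p = 0 := Finset.sum_eq_zero fun v _ => by
          rw [← hg v, show sgnPow (p / q) (f v - t) = 0 from congrFun hz v, abs_zero,
            Real.zero_rpow hq0.ne']
        linarith
      have h1 := poincareConst_le G q _ ht hg0
      rw [ratio_eq] at h1
      have hgs := gradSum_nonneg G q (fun v => sgnPow (p / q) (f v - t))
      have h2 := Real.rpow_le_rpow (poincareConst_nonneg G q) h1 hq0.le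
      simp only [hg] at h2
      rw [← Real.rpow_mul (by positivity), one_div_mul_cancel hq0.ne', Real.rpow_one] at h2
      refine h2.trans ?_
      have h3 : gradSum G q (fun v => sgnPow (p / q) (f v - t)) ≤ 2 ^ q * gradSum G p f := by
        refine gradSum_le_of_le G p q _ f _ fun x y => ?_
        have h4 := sgnPow_sub (p / q) (f x - t) (f y - t) ha ha1
        rw [sub_sub_sub_cancel_right] at h4
        refine (Real.rpow_le_rpow (abs_nonneg _) h4 hq0.le).trans ?_
        rw [Real.mul_rpow (by norm_num) (by positivity), ← Real.rpow_mul (abs_nonneg _),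
          div_mul_cancel₀ _ hq0.ne']
      have hfs := gradSum_nonneg G p f
      rw [← mul_div_assoc, div_le_div_iff₀ hT hS]
      calc _ ≤ (2 ^ q * gradSum G p f) * (2 ^ p * ∑ v, |f v - t| ^ p) :=
            mul_le_mul h3 hsh hS.le (by positivity)
        _ = _ := by ring
    have hroot : (poincareConst G q ^ q / (2 ^ q * 2 ^ p)) ^ (1 / p) ≤ poincareConst G p := by
      obtain ⟨f, h0, hf⟩ := hne
      refine le_csInf ⟨_, f, h0, hf, rfl⟩ ?_
      rintro c ⟨f, h0, hf, rfl⟩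
      rw [ratio_eq]
      have := poincareConst_nonneg G q
      refine Real.rpow_le_rpow (by positivity) ?_ (by positivity)
      rw [div_le_iff₀' (by positivity)]
      exact key f h0 hf
    have hn := poincareConst_nonneg G q
    have h5 := Real.rpow_le_rpow (by positivity) hroot hp0.le
    rw [← Real.rpow_mul (by positivity), one_div_mul_cancel hp0.ne', Real.rpow_one,
      div_le_iff₀' (by positivity)] at h5
    exact h5
  · have : poincareConst G q = 0 := by
      unfold poincareConst
      convert Real.sInf_empty
      ext c
      simp only [Set.mem_setOf_eq, Set.mem_empty_iff_false, iff_false]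
      rintro ⟨f, h0, hf, -⟩
      exact hne ⟨f, h0, hf⟩
    have h6 := poincareConst_nonneg G p
    rw [this, Real.zero_rpow hq0.ne']
    positivity

lemma le_profile {V : Type*} (X : SimpleGraph V) (p r : ℝ) (hp : 1 ≤ p)
    (s : Finset V) (G : SimpleGraph s) (hG : ∀ u v : s, G.Adj u v → X.Adj u v)
    (hs : (s.card : ℝ) ≤ r) : (s.card : ℝ) * poincareConst G p ≤ poincareProfile X p r := by
  refine le_csSup ⟨r * (r ^ 2 * 2 ^ p) ^ (1 / p), ?_⟩ ⟨s, G, hG, hs, rfl⟩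
  rintro c ⟨s, G, hG, hs, rfl⟩
  have h0 : (0 : ℝ) ≤ s.card := Nat.cast_nonneg _
  refine mul_le_mul hs ?_ (poincareConst_nonneg _ _) (h0.trans hs)
  refine (poincareConst_bound G p hp).trans ?_
  rw [Fintype.card_coe]
  gcongr

/-- For a bounded degree graph `X` and `1 ≤ p ≤ q < ∞`: if
`Λ^p_X(r) ≤ C (Cr+C)^(1-1/p) + C` for all `r ≥ 1` and some `C > 0`, then there is `C' > 0`
with `Λ^q_X(r) ≤ C' (C'r+C')^(1-1/q) + C'` for all `r ≥ 1`.  That is, the set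
`{ p ∈ [1,∞) : Λ^p_X(r) ≲ r^(1-1/p) }` is upward closed, hence an interval of the form
`(p_Λ(X),∞)`, `[p_Λ(X),∞)` or `∅`, where `p_Λ(X) = inf { p ≥ 1 : Λ^p_X(r) ≲ r^(1-1/p) }`. -/
theorem poincareProfile_upward_closed {V : Type*} (X : SimpleGraph V) (D : ℕ)
    (hdeg : ∀ v : V, {u : V | X.Adj v u}.Finite ∧ {u : V | X.Adj v u}.ncard ≤ D)
    (p q : ℝ) (hp : 1 ≤ p) (hpq : p ≤ q)
    (h : ∃ C > 0, ∀ r : ℝ, 1 ≤ r →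
      poincareProfile X p r ≤ C * (C * r + C) ^ (1 - 1 / p) + C) :
    ∃ C' > 0, ∀ r : ℝ, 1 ≤ r →
      poincareProfile X q r ≤ C' * (C' * r + C') ^ (1 - 1 / q) + C' := by
  obtain ⟨C, hC, h⟩ := h
  have hp0 : 0 < p := by linarith
  have hq0 : 0 < q := by linarith
  have hep : 0 ≤ 1 - 1 / p := by
    rw [sub_nonneg, div_le_one hp0]; exact hp
  have heq : 0 ≤ 1 - 1 / q := by
    rw [sub_nonneg, div_le_one hq0]; linarith
  set K : ℝ := C * (2 * C) ^ (1 - 1 / p) + C with hK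
  have hK0 : 0 < K := by positivity
  set M : ℝ := (2 ^ q * 2 ^ p * K ^ p) ^ (1 / q) with hM
  have hM0 : 0 < M := by positivity
  refine ⟨max 1 M, by positivity, fun r hr => ?_⟩
  have h1M : 1 ≤ max 1 M := le_max_left _ _
  have hMM : M ≤ max 1 M := le_max_right _ _
  refine Real.sSup_le ?_ (by positivity)
  rintro c ⟨s, G, hG, hs, rfl⟩
  rcases Nat.eq_zero_or_pos s.card with hz | hpos
  · rw [hz, Nat.cast_zero, zero_mul]
    positivity
  set n : ℝ := (s.card : ℝ) with hn
  have hn1 : 1 ≤ n := by rw [hn]; exact_mod_cast hpos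
  have hn0 : 0 < n := by linarith
  have hP0 := poincareConst_nonneg G p
  have hQ0 := poincareConst_nonneg G q
  have h1 : n * poincareConst G p ≤ K * n ^ (1 - 1 / p) := by
    refine ((le_profile X p n hp s G hG le_rfl).trans (h n hn1)).trans ?_
    have h2 : (C * n + C) ^ (1 - 1 / p) ≤ (2 * C) ^ (1 - 1 / p) * n ^ (1 - 1 / p) := by
      rw [← Real.mul_rpow (by positivity) hn0.le]
      refine Real.rpow_le_rpow (by positivity) ?_ hep
      nlinarith
    have h3 : 1 ≤ n ^ (1 - 1 / p) := Real.one_le_rpow hn1 hep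
    rw [hK]
    nlinarith [mul_le_mul_of_nonneg_left h2 hC.le, mul_le_mul_of_nonneg_left h3 hC.le]
  have h2 : poincareConst G p ^ p ≤ K ^ p / n := by
    have h3 : poincareConst G p ≤ K * n ^ (-(1 / p)) := by
      rw [sub_eq_add_neg, Real.rpow_add hn0, Real.rpow_one] at h1
      refine le_of_mul_le_mul_left (h1.trans (le_of_eq ?_)) hn0
      ring
    refine (Real.rpow_le_rpow hP0 h3 hp0.le).trans (le_of_eq ?_)
    rw [Real.mul_rpow hK0.le (by positivity), ← Real.rpow_mul hn0.le, neg_mul,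
      one_div_mul_cancel hp0.ne', Real.rpow_neg_one, div_eq_mul_inv]
  have h3 : poincareConst G q ^ q ≤ 2 ^ q * 2 ^ p * K ^ p / n := by
    refine (poincareConst_compare G p q hp hpq).trans ?_
    rw [mul_div_assoc]
    gcongr
  have h4 : poincareConst G q ≤ M * n ^ (-(1 / q)) := by
    have h5 := Real.rpow_le_rpow (by positivity) h3 (by positivity : 0 ≤ 1 / q)
    rw [← Real.rpow_mul hQ0, mul_one_div_cancel hq0.ne', Real.rpow_one,
      Real.div_rpow (by positivity) hn0.le] at h5
    rwa [Real.rpow_neg hn0.le, ← div_eq_mul_inv]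
  have h5 : n * poincareConst G q ≤ M * n ^ (1 - 1 / q) := by
    rw [sub_eq_add_neg, Real.rpow_add hn0, Real.rpow_one]
    refine (mul_le_mul_of_nonneg_left h4 hn0.le).trans (le_of_eq ?_)
    ring
  refine h5.trans ?_
  have h6 : n ^ (1 - 1 / q) ≤ (max 1 M * r + max 1 M) ^ (1 - 1 / q) := by
    refine Real.rpow_le_rpow hn0.le ?_ heq
    nlinarith
  have h7 : M * n ^ (1 - 1 / q) ≤ max 1 M * (max 1 M * r + max 1 M) ^ (1 - 1 / q) :=
    mul_le_mul hMM h6 (by positivity) (by positivity)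
  linarith
end

section
/- Let Γ be a finite simple graph with at least two vertices, suppose for every ordered pair (w_0, w_1) of vertices a path γ_{w_0,w_1} in Γ from w_0 to w_1 has been chosen, and for each edge e let M_e denote the number of ordered pairs (w_0,w_1) whose chosen path contains e. Then h^1(Γ) ≥ |Γ| / max_{e ∈ E(Γ)} M_e. -/
open Finset

/-- The `L^1`-Poincaré constant
`h^1(Γ) = inf { ‖∇f‖₁ / ‖f‖₁ : f : V(Γ) → ℝ, ∑ v, f v = 0, f ≢ 0 }`, where
`‖f‖₁ = ∑ v, |f v|` and `‖∇f‖₁ = ∑ e ∈ E(Γ), |f x_e - f y_e|`. -/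
noncomputable def poincareConstOne {V : Type*} [Fintype V] (G : SimpleGraph V) : ℝ :=
  letI := Classical.decEq V
  letI := Classical.decRel G.Adj
  sInf { c : ℝ | ∃ f : V → ℝ, (∑ v, f v) = 0 ∧ f ≠ 0 ∧
    c = (∑ e ∈ G.edgeFinset,
          Sym2.lift ⟨fun x y => |f x - f y|,
            fun x y => by show |f x - f y| = |f y - f x|; rw [abs_sub_comm]⟩ e) /
        (∑ v, |f v|) }

/-- `M_e`: the number of ordered pairs `(w₀, w₁)` of vertices whose chosen path
`γ w₀ w₁` contains the edge `e`. -/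
noncomputable def pathCount {V : Type*} [Fintype V] (G : SimpleGraph V)
    (γ : ∀ w0 w1 : V, G.Path w0 w1) (e : Sym2 V) : ℕ :=
  Nat.card { w : V × V // e ∈ (γ w.1 w.2).val.edges }

theorem aux_walk_le {V : Type*} (G : SimpleGraph V) (f : V → ℝ) (g : Sym2 V → ℝ)
    (hg : ∀ x y, g s(x, y) = |f x - f y|) {u v : V} (p : G.Walk u v) :
    |f u - f v| ≤ (p.edges.map g).sum := by
  induction p with
  | nil => simp
  | cons h p ih =>
    simp only [SimpleGraph.Walk.edges_cons, List.map_cons, List.sum_cons, hg]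
    exact (abs_sub_le _ _ _).trans (add_le_add le_rfl ih)

/-- **path-counting lower bound, case `p = 1`.**
Given chosen paths `γ_{w₀,w₁}` between all ordered pairs of vertices of a finite simple
graph `Γ` with at least two vertices, and `M_e` the number of pairs whose path uses the
edge `e`: `h^1(Γ) ≥ |Γ| / max_{e ∈ E(Γ)} M_e`. -/
theorem poincareConstOne_ge_of_paths {V : Type*} [Fintype V] [DecidableEq V]
    (G : SimpleGraph V) (hcard : 2 ≤ Fintype.card V)
    (γ : ∀ w0 w1 : V, G.Path w0 w1) :
    (Fintype.card V : ℝ) /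
      sSup { x : ℝ | ∃ e ∈ G.edgeSet, x = (pathCount G γ e : ℝ) }
      ≤ poincareConstOne G := by
  classical
  set M := sSup { x : ℝ | ∃ e ∈ G.edgeSet, x = (pathCount G γ e : ℝ) } with hM
  have hMe : ∀ e ∈ G.edgeSet, (pathCount G γ e : ℝ) ≤ M := by
    intro e he
    refine le_csSup ?_ ⟨e, he, rfl⟩
    refine ((Set.finite_range fun e : Sym2 V => (pathCount G γ e : ℝ)).subset ?_).bddAbove
    rintro x ⟨e, -, rfl⟩
    exact ⟨e, rfl⟩
  have hM0 : 0 ≤ M := by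
    apply Real.sSup_nonneg
    rintro x ⟨e, -, rfl⟩
    positivity
  unfold poincareConstOne
  refine le_csInf ?_ ?_
  · obtain ⟨a, b, hab⟩ := Fintype.exists_pair_of_one_lt_card (by omega : 1 < Fintype.card V)
    refine ⟨_, fun v => (if v = a then 1 else 0) - (if v = b then 1 else 0), ?_, ?_, rfl⟩
    · simp
    · intro h
      have := congrFun h a
      simp [hab] at this
  · rintro c ⟨f, hf, hf0, rfl⟩
    set g : Sym2 V → ℝ := Sym2.lift ⟨fun x y => |f x - f y|,
            fun x y => by show |f x - f y| = |f y - f x|; rw [abs_sub_comm]⟩ with hgdef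
    have hg : ∀ x y, g s(x, y) = |f x - f y| := fun x y => rfl
    have hg0 : ∀ e, 0 ≤ g e := by
      intro e
      induction e with
      | _ x y => rw [hg]; positivity
    have hpos : 0 < ∑ v, |f v| := by
      obtain ⟨v, hv⟩ := Function.ne_iff.mp hf0
      exact Finset.sum_pos' (fun _ _ => abs_nonneg _) ⟨v, Finset.mem_univ _, abs_pos.mpr hv⟩
    have hpath : ∀ u v, |f u - f v| ≤
        ∑ e ∈ G.edgeFinset, if e ∈ (γ u v).val.edges then g e else 0 := by
      intro u v
      refine (aux_walk_le G f g hg (γ u v).val).trans ?_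
      rw [← List.sum_toFinset g (γ u v).property.isTrail.edges_nodup, ← Finset.sum_filter]
      refine Finset.sum_le_sum_of_subset_of_nonneg ?_ (fun e _ _ => hg0 e)
      intro e he
      rw [List.mem_toFinset] at he
      simp only [Finset.mem_filter, SimpleGraph.mem_edgeFinset]
      exact ⟨(γ u v).val.edges_subset_edgeSet he, he⟩
    have key : (Fintype.card V : ℝ) * ∑ v, |f v| ≤ M * ∑ e ∈ G.edgeFinset, g e := by
      calc (Fintype.card V : ℝ) * ∑ v, |f v|
          = ∑ v, |∑ w, (f v - f w)| := by
            rw [Finset.mul_sum]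
            refine Finset.sum_congr rfl fun v _ => ?_
            rw [Finset.sum_sub_distrib, hf]
            simp [abs_mul]
        _ ≤ ∑ v, ∑ w, |f v - f w| :=
            Finset.sum_le_sum fun v _ => Finset.abs_sum_le_sum_abs _ _
        _ ≤ ∑ v, ∑ w, ∑ e ∈ G.edgeFinset, (if e ∈ (γ v w).val.edges then g e else 0) :=
            Finset.sum_le_sum fun v _ => Finset.sum_le_sum fun w _ => hpath v w
        _ = ∑ w : V × V, ∑ e ∈ G.edgeFinset,
              (if e ∈ (γ w.1 w.2).val.edges then g e else 0) := by
            rw [Fintype.sum_prod_type]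
        _ = ∑ e ∈ G.edgeFinset, (pathCount G γ e : ℝ) * g e := by
            rw [Finset.sum_comm]
            refine Finset.sum_congr rfl fun e _ => ?_
            rw [← Finset.sum_filter, Finset.sum_const, nsmul_eq_mul, pathCount,
              Nat.card_eq_fintype_card, Fintype.card_subtype]
        _ ≤ M * ∑ e ∈ G.edgeFinset, g e := by
            rw [Finset.mul_sum]
            refine Finset.sum_le_sum fun e he => ?_
            exact mul_le_mul_of_nonneg_right
              (hMe e (SimpleGraph.mem_edgeFinset.mp he)) (hg0 e)
    have goal : (Fintype.card V : ℝ) / M ≤ (∑ e ∈ G.edgeFinset, g e) / ∑ v, |f v| := by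
      rcases hM0.eq_or_lt with h | h
      · rw [← h, div_zero]
        exact div_nonneg (Finset.sum_nonneg fun e _ => hg0 e) hpos.le
      · rw [div_le_div_iff₀ h hpos]
        linarith
    convert goal
end

section
/- Let Γ be a finite simple graph with at least two vertices, suppose for every ordered pair (w_0, w_1) of vertices a path γ_{w_0,w_1} in Γ from w_0 to w_1 has been chosen, and for each edge e let M_e denote the number of ordered pairs (w_0,w_1) whose chosen path contains e. Let p > 1, let f : V(Γ) → ℝ, and let f_Γ = (1/|Γ|)·∑_{v ∈ V(Γ)} f(v). Then ∑_{v ∈ V(Γ)} |f(v) − f_Γ|^p ≤ (1/|Γ|) · ( ∑_{e ∈ E(Γ)} |f(x_e) − f(y_e)|^p ) · max_{w_0,w_1 ∈ V(Γ)} ( ∑_{e ∈ γ_{w_0,w_1}} M_e^{1/(p−1)} )^{p−1}. -/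
open Finset

lemma walk_abs_sub_le {V : Type*} (G : SimpleGraph V) (f : V → ℝ) (d : Sym2 V → ℝ)
    (hd : ∀ x y, d s(x, y) = |f x - f y|) {a b : V} (w : G.Walk a b) :
    |f a - f b| ≤ (w.edges.map d).sum := by
  induction w with
  | nil => simp
  | cons h w ih =>
    rename_i u v x
    simp only [SimpleGraph.Walk.edges_cons, List.map_cons, List.sum_cons, hd]
    have := abs_sub_le (f u) (f v) (f x)
    linarith

lemma holder_weighted {ι : Type*} (s : Finset ι) (d M : ι → ℝ) (hd : ∀ i ∈ s, 0 ≤ d i)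
    (hM : ∀ i ∈ s, 0 < M i) (p : ℝ) (hp : 1 < p) :
    (∑ i ∈ s, d i) ^ p ≤
      (∑ i ∈ s, M i ^ (1 / (p - 1))) ^ (p - 1) * ∑ i ∈ s, d i ^ p / M i := by
  have hp0 : 0 < p := by linarith
  have hp1 : 0 < p - 1 := by linarith
  have hpq := Real.HolderConjugate.conjExponent hp
  have h := Real.inner_le_Lp_mul_Lq_of_nonneg s hpq
    (f := fun i => d i * M i ^ (-(1 / p))) (g := fun i => M i ^ (1 / p))
    (fun i hi => mul_nonneg (hd i hi) (Real.rpow_nonneg (hM i hi).le _))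
    (fun i hi => Real.rpow_nonneg (hM i hi).le _)
  have e1 : ∑ i ∈ s, d i * M i ^ (-(1 / p)) * M i ^ (1 / p) = ∑ i ∈ s, d i := by
    refine Finset.sum_congr rfl fun i hi => ?_
    rw [mul_assoc, ← Real.rpow_add (hM i hi)]
    simp
  have e2 : ∑ i ∈ s, (d i * M i ^ (-(1 / p))) ^ p = ∑ i ∈ s, d i ^ p / M i := by
    refine Finset.sum_congr rfl fun i hi => ?_
    rw [Real.mul_rpow (hd i hi) (Real.rpow_nonneg (hM i hi).le _),
      ← Real.rpow_mul (hM i hi).le]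
    have : -(1 / p) * p = -1 := by field_simp
    rw [this, Real.rpow_neg_one, div_eq_mul_inv]
  have e3 : ∑ i ∈ s, (M i ^ (1 / p)) ^ (p.conjExponent) = ∑ i ∈ s, M i ^ (1 / (p - 1)) := by
    refine Finset.sum_congr rfl fun i hi => ?_
    rw [← Real.rpow_mul (hM i hi).le]
    congr 1
    unfold Real.conjExponent
    field_simp
  rw [e1, e2, e3] at h
  have n1 : 0 ≤ ∑ i ∈ s, d i ^ p / M i :=
    Finset.sum_nonneg fun i hi => div_nonneg (Real.rpow_nonneg (hd i hi) _) (hM i hi).le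
  have n2 : 0 ≤ ∑ i ∈ s, M i ^ (1 / (p - 1)) :=
    Finset.sum_nonneg fun i hi => Real.rpow_nonneg (hM i hi).le _
  have h2 := Real.rpow_le_rpow (Finset.sum_nonneg hd) h hp0.le
  rw [Real.mul_rpow (Real.rpow_nonneg n1 _) (Real.rpow_nonneg n2 _), ← Real.rpow_mul n1,
    ← Real.rpow_mul n2] at h2
  have a1 : 1 / p * p = 1 := by field_simp
  have a2 : 1 / p.conjExponent * p = p - 1 := by unfold Real.conjExponent; field_simp
  rw [a1, a2, Real.rpow_one, mul_comm] at h2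
  exact h2

lemma jensen_avg {V : Type*} [Fintype V] (hcard : 2 ≤ Fintype.card V) (p : ℝ) (hp : 1 < p)
    (f : V → ℝ) (v : V) :
    |f v - (∑ w, f w) / (Fintype.card V : ℝ)| ^ p ≤
      (Fintype.card V : ℝ)⁻¹ * ∑ w, |f v - f w| ^ p := by
  have hn : (0 : ℝ) < Fintype.card V := by
    have : 0 < Fintype.card V := by omega
    exact_mod_cast this
  have h := Real.rpow_arith_mean_le_arith_mean_rpow Finset.univ
    (fun _ : V => (Fintype.card V : ℝ)⁻¹) (fun w => |f v - f w|)
    (fun _ _ => by positivity) (by simp [hn.ne']) (fun _ _ => abs_nonneg _) hp.le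
  rw [← Finset.mul_sum, ← Finset.mul_sum] at h
  refine le_trans (Real.rpow_le_rpow (abs_nonneg _) ?_ (by linarith)) h
  have : f v - (∑ w, f w) / (Fintype.card V : ℝ)
      = (Fintype.card V : ℝ)⁻¹ * ∑ w, (f v - f w) := by
    rw [Finset.sum_sub_distrib]
    simp
    field_simp
  rw [this, abs_mul, abs_of_pos (inv_pos.mpr hn)]
  exact mul_le_mul_of_nonneg_left (Finset.abs_sum_le_sum_abs _ _) (by positivity)

/-- **Poincaré inequality along chosen paths, case `p > 1`.**
For a finite simple graph `Γ` with at least two vertices, chosen paths `γ_{w₀,w₁}`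
between all ordered pairs of vertices, `M_e` the number of pairs whose path uses the
edge `e`, `p > 1`, `f : V(Γ) → ℝ`, and `f_Γ` the average of `f`:
`∑_v |f v - f_Γ|^p ≤ (1/|Γ|) (∑_{e ∈ E(Γ)} |f x_e - f y_e|^p) ·
  max_{w₀,w₁} (∑_{e ∈ γ_{w₀,w₁}} M_e^(1/(p-1)))^(p-1)`. -/
theorem sum_abs_sub_avg_pow_le {V : Type*} [Fintype V] [DecidableEq V]
    (G : SimpleGraph V) [DecidableRel G.Adj] (hcard : 2 ≤ Fintype.card V)
    (γ : ∀ w0 w1 : V, G.Path w0 w1) (p : ℝ) (hp : 1 < p) (f : V → ℝ) :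
    ∑ v, |f v - (∑ w, f w) / (Fintype.card V : ℝ)| ^ p ≤
      (Fintype.card V : ℝ)⁻¹ *
      (∑ e ∈ G.edgeFinset,
        Sym2.lift ⟨fun x y => |f x - f y| ^ p,
          fun x y => by show |f x - f y| ^ p = |f y - f x| ^ p; rw [abs_sub_comm]⟩ e) *
      sSup { x : ℝ | ∃ w0 w1 : V,
        x = (∑ e ∈ (γ w0 w1).val.edges.toFinset,
              (pathCount G γ e : ℝ) ^ (1 / (p - 1))) ^ (p - 1) } := by
  classical
  have hn : (0 : ℝ) < Fintype.card V := by
    have : 0 < Fintype.card V := by omega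
    exact_mod_cast this
  set D : Sym2 V → ℝ := fun e => Sym2.lift ⟨fun x y => |f x - f y| ^ p,
          fun x y => by show |f x - f y| ^ p = |f y - f x| ^ p; rw [abs_sub_comm]⟩ e with hD
  set S : Set ℝ := { x : ℝ | ∃ w0 w1 : V,
        x = (∑ e ∈ (γ w0 w1).val.edges.toFinset,
              (pathCount G γ e : ℝ) ^ (1 / (p - 1))) ^ (p - 1) } with hS
  let d : Sym2 V → ℝ := fun e => Sym2.lift ⟨fun x y => |f x - f y|,
          fun x y => abs_sub_comm _ _⟩ e
  have hd : ∀ x y, d s(x, y) = |f x - f y| := fun x y => rfl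
  have hd0 : ∀ e, 0 ≤ d e := by
    intro e
    induction e using Sym2.ind with
    | _ x y => rw [hd]; exact abs_nonneg _
  have hdD : ∀ e, D e = d e ^ p := by
    intro e
    induction e using Sym2.ind with
    | _ x y => rfl
  have hbdd : BddAbove S := by
    have : S = Set.range (fun w : V × V => (∑ e ∈ (γ w.1 w.2).val.edges.toFinset,
              (pathCount G γ e : ℝ) ^ (1 / (p - 1))) ^ (p - 1)) := by
      ext x
      simp [hS, eq_comm]
    rw [this]
    exact (Set.finite_range _).bddAbove
  have hMcard : ∀ e, pathCount G γ e =
      (Finset.univ.filter fun w : V × V => e ∈ (γ w.1 w.2).val.edges).card := by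
    intro e
    rw [pathCount, Nat.card_eq_fintype_card, Fintype.card_subtype]
  have hMpos : ∀ v w, ∀ e ∈ (γ v w).val.edges.toFinset, (0 : ℝ) < pathCount G γ e := by
    intro v w e he
    rw [hMcard]
    have : 0 < (Finset.univ.filter fun w : V × V => e ∈ (γ w.1 w.2).val.edges).card :=
      Finset.card_pos.mpr ⟨(v, w), by simpa using he⟩
    exact_mod_cast this
  have key : ∀ v w, |f v - f w| ^ p ≤
      sSup S * ∑ e ∈ (γ v w).val.edges.toFinset, D e / pathCount G γ e := by
    intro v w
    have h1 := walk_abs_sub_le G f d hd (γ v w).val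
    rw [← List.sum_toFinset d (γ v w).property.isTrail.edges_nodup] at h1
    have h2 := holder_weighted _ d (fun e => (pathCount G γ e : ℝ)) (fun e _ => hd0 e)
      (hMpos v w) p hp
    refine (Real.rpow_le_rpow (abs_nonneg _) h1 (by linarith)).trans (h2.trans ?_)
    simp only [hdD]
    refine mul_le_mul_of_nonneg_right (le_csSup hbdd ⟨v, w, rfl⟩) ?_
    exact Finset.sum_nonneg fun e _ => div_nonneg (Real.rpow_nonneg (hd0 e) _) (by positivity)
  have hSnn : 0 ≤ sSup S := by
    refine Real.sSup_nonneg ?_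
    rintro x ⟨v, w, rfl⟩
    positivity
  have swap : ∑ v, ∑ w, ∑ e ∈ (γ v w).val.edges.toFinset, D e / (pathCount G γ e : ℝ)
      ≤ ∑ e ∈ G.edgeFinset, D e := by
    rw [← Fintype.sum_prod_type'
      (f := fun v w => ∑ e ∈ (γ v w).val.edges.toFinset, D e / (pathCount G γ e : ℝ))]
    rw [Finset.sum_comm' (t' := G.edgeFinset)
      (s' := fun e => Finset.univ.filter fun w : V × V => e ∈ (γ w.1 w.2).val.edges)]
    · refine Finset.sum_le_sum fun e _ => ?_
      rw [Finset.sum_const, ← hMcard, nsmul_eq_mul]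
      by_cases h0 : (pathCount G γ e : ℝ) = 0
      · rw [h0, zero_mul, hdD]
        exact Real.rpow_nonneg (hd0 e) _
      · rw [mul_div_cancel₀ _ h0]
    · intro w e
      simp only [Finset.mem_univ, true_and, List.mem_toFinset, Finset.mem_filter,
        SimpleGraph.mem_edgeFinset]
      exact ⟨fun h => ⟨h, (γ w.1 w.2).val.edges_subset_edgeSet h⟩, fun h => h.1⟩
  calc ∑ v, |f v - (∑ w, f w) / (Fintype.card V : ℝ)| ^ p
      ≤ ∑ v, (Fintype.card V : ℝ)⁻¹ * ∑ w, |f v - f w| ^ p :=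
        Finset.sum_le_sum fun v _ => jensen_avg hcard p hp f v
    _ ≤ ∑ v, (Fintype.card V : ℝ)⁻¹ * ∑ w,
          sSup S * ∑ e ∈ (γ v w).val.edges.toFinset, D e / pathCount G γ e :=
        Finset.sum_le_sum fun v _ => mul_le_mul_of_nonneg_left
          (Finset.sum_le_sum fun w _ => key v w) (by positivity)
    _ = (Fintype.card V : ℝ)⁻¹ * (sSup S *
          ∑ v, ∑ w, ∑ e ∈ (γ v w).val.edges.toFinset, D e / (pathCount G γ e : ℝ)) := by
        simp only [← Finset.mul_sum]
    _ ≤ (Fintype.card V : ℝ)⁻¹ * (sSup S * ∑ e ∈ G.edgeFinset, D e) :=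
        mul_le_mul_of_nonneg_left (mul_le_mul_of_nonneg_left swap hSnn) (by positivity)
    _ = _ := by ring
end

section
/- Let Γ be a finite simple graph with at least two vertices, suppose for every ordered pair (w_0, w_1) of vertices a path γ_{w_0,w_1} in Γ from w_0 to w_1 has been chosen, and for each edge e let M_e denote the number of ordered pairs (w_0,w_1) whose chosen path contains e. Let f : V(Γ) → ℝ and let f_Γ = (1/|Γ|)·∑_{v ∈ V(Γ)} f(v). Then ∑_{v ∈ V(Γ)} |f(v) − f_Γ| ≤ (1/|Γ|) · ( ∑_{e ∈ E(Γ)} |f(x_e) − f(y_e)| ) · max_{e ∈ E(Γ)} M_e. -/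
open Finset

/-- Triangle inequality along a walk. -/
theorem abs_sub_le_sum_edges {V : Type*} (G : SimpleGraph V) (f : V → ℝ) (D : Sym2 V → ℝ)
    (hD : ∀ x y, D s(x, y) = |f x - f y|) {u v : V} (p : G.Walk u v) :
    |f u - f v| ≤ (p.edges.map D).sum := by
  induction p with
  | nil => simp
  | @cons a b c h p ih =>
    simp only [SimpleGraph.Walk.edges_cons, List.map_cons, List.sum_cons, hD]
    exact (abs_sub_le (f a) (f b) (f c)).trans (by gcongr)

/-- For a path, the sum over its edges is a sum over all edges with an indicator. -/
theorem abs_sub_le_sum_ite {V : Type*} [Fintype V] [DecidableEq V] (G : SimpleGraph V)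
    [DecidableRel G.Adj] (f : V → ℝ) (D : Sym2 V → ℝ)
    (hD : ∀ x y, D s(x, y) = |f x - f y|) {u v : V} (p : G.Path u v) :
    |f u - f v| ≤ ∑ e ∈ G.edgeFinset, if e ∈ p.val.edges then D e else 0 := by
  refine (abs_sub_le_sum_edges G f D hD p.val).trans (le_of_eq ?_)
  rw [← List.sum_toFinset D p.property.isTrail.edges_nodup, ← Finset.sum_filter]
  refine Finset.sum_congr ?_ fun _ _ => rfl
  ext e
  simp only [List.mem_toFinset, Finset.mem_filter, SimpleGraph.mem_edgeFinset]
  exact ⟨fun h => ⟨p.val.edges_subset_edgeSet h, h⟩, fun h => h.2⟩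

/-- **Poincaré inequality along chosen paths, case `p = 1`.**
For a finite simple graph `Γ` with at least two vertices, chosen paths `γ_{w₀,w₁}`
between all ordered pairs of vertices, `M_e` the number of pairs whose path uses the
edge `e`, `f : V(Γ) → ℝ`, and `f_Γ` the average of `f`:
`∑_v |f v - f_Γ| ≤ (1/|Γ|) (∑_{e ∈ E(Γ)} |f x_e - f y_e|) · max_{e ∈ E(Γ)} M_e`. -/
theorem sum_abs_sub_avg_le {V : Type*} [Fintype V] [DecidableEq V]
    (G : SimpleGraph V) [DecidableRel G.Adj] (hcard : 2 ≤ Fintype.card V)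
    (γ : ∀ w0 w1 : V, G.Path w0 w1) (f : V → ℝ) :
    ∑ v, |f v - (∑ w, f w) / (Fintype.card V : ℝ)| ≤
      (Fintype.card V : ℝ)⁻¹ *
      (∑ e ∈ G.edgeFinset,
        Sym2.lift ⟨fun x y => |f x - f y|,
          fun x y => by show |f x - f y| = |f y - f x|; rw [abs_sub_comm]⟩ e) *
      sSup { x : ℝ | ∃ e ∈ G.edgeSet, x = (pathCount G γ e : ℝ) } := by
  set D : Sym2 V → ℝ := Sym2.lift ⟨fun x y => |f x - f y|,
          fun x y => by show |f x - f y| = |f y - f x|; rw [abs_sub_comm]⟩ with hDdef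
  have hD : ∀ x y, D s(x, y) = |f x - f y| := fun x y => rfl
  have hD0 : ∀ e, 0 ≤ D e := by
    intro e
    induction e using Sym2.ind with
    | _ x y => rw [hD]; exact abs_nonneg _
  set S := { x : ℝ | ∃ e ∈ G.edgeSet, x = (pathCount G γ e : ℝ) } with hS
  have hbdd : BddAbove S := by
    have : S.Finite := (Set.toFinite (Set.range fun e : Sym2 V => (pathCount G γ e : ℝ))).subset
      (by rintro x ⟨e, _, rfl⟩; exact ⟨e, rfl⟩)
    exact this.bddAbove
  have hn : (0 : ℝ) < Fintype.card V := by
    have : 0 < Fintype.card V := by omega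
    exact_mod_cast this
  have h1 : ∀ v, |f v - (∑ w, f w) / (Fintype.card V : ℝ)| ≤
      (Fintype.card V : ℝ)⁻¹ * ∑ w, |f v - f w| := by
    intro v
    have : f v - (∑ w, f w) / (Fintype.card V : ℝ) =
        (Fintype.card V : ℝ)⁻¹ * ∑ w, (f v - f w) := by
      rw [Finset.sum_sub_distrib]
      simp only [Finset.sum_const, Finset.card_univ, nsmul_eq_mul]
      field_simp
    rw [this, abs_mul, abs_of_pos (inv_pos.mpr hn)]
    gcongr
    exact Finset.abs_sum_le_sum_abs _ _
  have hcount : ∀ e, ∑ v, ∑ w, (if e ∈ (γ v w).val.edges then D e else 0) =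
      D e * (pathCount G γ e : ℝ) := by
    intro e
    rw [← Fintype.sum_prod_type' (fun v w => if e ∈ (γ v w).val.edges then D e else 0),
      ← Finset.sum_filter, Finset.sum_const, nsmul_eq_mul, mul_comm, pathCount,
      Nat.card_eq_fintype_card, Fintype.card_subtype]
  calc ∑ v, |f v - (∑ w, f w) / (Fintype.card V : ℝ)|
      ≤ ∑ v, (Fintype.card V : ℝ)⁻¹ * ∑ w, |f v - f w| := Finset.sum_le_sum fun v _ => h1 v
    _ = (Fintype.card V : ℝ)⁻¹ * ∑ v, ∑ w, |f v - f w| := by rw [Finset.mul_sum]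
    _ ≤ (Fintype.card V : ℝ)⁻¹ * ∑ v, ∑ w, ∑ e ∈ G.edgeFinset,
          (if e ∈ (γ v w).val.edges then D e else 0) := by
        gcongr with v _ w _
        exact abs_sub_le_sum_ite G f D hD (γ v w)
    _ = (Fintype.card V : ℝ)⁻¹ * ∑ e ∈ G.edgeFinset, D e * (pathCount G γ e : ℝ) := by
        congr 1
        simp_rw [← hcount]
        rw [Finset.sum_comm' (t' := Finset.univ) (s' := fun _ => G.edgeFinset) (by simp [and_comm])]
        exact Finset.sum_congr rfl fun v _ => Finset.sum_comm
    _ ≤ (Fintype.card V : ℝ)⁻¹ * ∑ e ∈ G.edgeFinset, D e * sSup S := by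
        gcongr with e he
        · exact hD0 e
        · exact le_csSup hbdd ⟨e, SimpleGraph.mem_edgeFinset.mp he, rfl⟩
    _ = _ := by rw [← Finset.sum_mul, mul_assoc]
end

section
/- Let (X, ρ) be a metric space, let λ ≥ 1 and δ > 0, and let J : [0,1] → X be a topological embedding whose image is a δ-local λ-quasi-arc. Set s = δ/(4λ). Let N ≥ 2 and let 0 = t_1 < t_2 < ⋯ < t_N = 1 be real numbers such that {J(t_1), …, J(t_N)} is a maximal s-separated subset of J([0,1]). Then for every 1 ≤ i < N, s ≤ diam J([t_i, t_{i+1}]) ≤ δ/2; in particular s ≤ ρ(J(t_i), J(t_{i+1})) ≤ δ/2. -/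
open Set Metric

/-- Let `(X, ρ)` be a metric space, `λ ≥ 1`, `δ > 0`, and let
`J : [0,1] → X` be a topological embedding whose image is a `δ`-local `λ`-quasi-arc,
i.e. whenever `u, u' ∈ [0,1]` with `ρ(J u, J u') ≤ δ`, the subarc between them has
diameter at most `λ·ρ(J u, J u')`.  Set `s = δ/(4λ)`.  If `0 = t₀ < t₁ < ⋯ < t_{N-1} = 1`
(`N ≥ 2`) are such that `{J t₀, …, J t_{N-1}}` is a maximal `s`-separated subset of
`J([0,1])`, then for every `i` with `i + 1 < N`:
`s ≤ diam J([tᵢ, tᵢ₊₁]) ≤ δ/2`, and in particular `s ≤ ρ(J tᵢ, J tᵢ₊₁) ≤ δ/2`. -/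
theorem quasiArc_net_diam {X : Type*} [MetricSpace X] (lam δ : ℝ)
    (hlam : 1 ≤ lam) (hδ : 0 < δ)
    (J : ℝ → X)
    (hemb : Topology.IsEmbedding fun u : Set.Icc (0 : ℝ) 1 => J u)
    (hqa : ∀ u ∈ Set.Icc (0 : ℝ) 1, ∀ u' ∈ Set.Icc (0 : ℝ) 1,
      dist (J u) (J u') ≤ δ →
        Metric.diam (J '' Set.Icc (min u u') (max u u')) ≤ lam * dist (J u) (J u'))
    (s : ℝ) (hs : s = δ / (4 * lam))
    (N : ℕ) (hN : 2 ≤ N) (t : Fin N → ℝ)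
    (hmono : StrictMono t)
    (ht0 : t ⟨0, by omega⟩ = 0) (ht1 : t ⟨N - 1, by omega⟩ = 1)
    (hsep : ∀ i j : Fin N, i ≠ j → s ≤ dist (J (t i)) (J (t j)))
    (hmax : ∀ x ∈ J '' Set.Icc (0 : ℝ) 1, ∃ i : Fin N, dist x (J (t i)) < s) :
    ∀ (i : Fin N) (hi : (i : ℕ) + 1 < N),
      s ≤ Metric.diam (J '' Set.Icc (t i) (t ⟨(i : ℕ) + 1, hi⟩)) ∧
      Metric.diam (J '' Set.Icc (t i) (t ⟨(i : ℕ) + 1, hi⟩)) ≤ δ / 2 ∧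
      s ≤ dist (J (t i)) (J (t ⟨(i : ℕ) + 1, hi⟩)) ∧
      dist (J (t i)) (J (t ⟨(i : ℕ) + 1, hi⟩)) ≤ δ / 2 := by
  intro i hi
  have hl0 : 0 < lam := by linarith
  have hs0 : 0 < s := by rw [hs]; positivity
  have hls : lam * s = δ / 4 := by rw [hs]; field_simp
  have hsδ : s ≤ δ := by nlinarith
  have hcont : ContinuousOn J (Set.Icc (0 : ℝ) 1) :=
    continuousOn_iff_continuous_restrict.2 hemb.continuous
  have htm : ∀ k : Fin N, t k ∈ Set.Icc (0 : ℝ) 1 := by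
    intro k
    constructor
    · rw [← ht0]; exact hmono.monotone (Fin.mk_le_of_le_val (Nat.zero_le _))
    · rw [← ht1]; exact hmono.monotone (Fin.le_def.2 (by have := k.2; simp only; omega))
  have hbdd : ∀ a b : ℝ, 0 ≤ a → b ≤ 1 → Bornology.IsBounded (J '' Set.Icc a b) := by
    intro a b ha hb
    exact (isCompact_Icc.image_of_continuousOn
      (hcont.mono (Set.Icc_subset_Icc ha hb))).isBounded
  set j : Fin N := ⟨(i : ℕ) + 1, hi⟩ with hj
  have hij : i < j := Fin.lt_def.2 (by simp [hj])
  have hle : t i ≤ t j := (hmono hij).le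
  have hsub : Set.Icc (t i) (t j) ⊆ Set.Icc (0 : ℝ) 1 :=
    Set.Icc_subset_Icc (htm i).1 (htm j).2
  have hd : dist (J (t i)) (J (t j)) ≤ Metric.diam (J '' Set.Icc (t i) (t j)) :=
    Metric.dist_le_diam_of_mem (hbdd _ _ (htm i).1 (htm j).2)
      ⟨_, Set.left_mem_Icc.2 hle, rfl⟩ ⟨_, Set.right_mem_Icc.2 hle, rfl⟩
  have hsd := hsep i j hij.ne
  have hpre : IsPreconnected (J '' Set.Icc (t i) (t j)) :=
    isPreconnected_Icc.image J (hcont.mono hsub)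
  have key := hpre (⋃ k : {k : Fin N // k ≤ i}, Metric.ball (J (t k)) s)
    (⋃ k : {k : Fin N // j ≤ k}, Metric.ball (J (t k)) s)
    (isOpen_iUnion fun _ => Metric.isOpen_ball) (isOpen_iUnion fun _ => Metric.isOpen_ball)
    (by
      rintro _ ⟨u, hu, rfl⟩
      obtain ⟨k, hk⟩ := hmax (J u) ⟨u, hsub hu, rfl⟩
      rcases le_or_gt k i with h | h
      · exact Or.inl (Set.mem_iUnion.2 ⟨⟨k, h⟩, hk⟩)
      · exact Or.inr (Set.mem_iUnion.2 ⟨⟨k, Fin.le_def.2 (by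
          have := Fin.lt_def.1 h; simp only [hj]; omega)⟩, hk⟩))
    ⟨J (t i), ⟨_, Set.left_mem_Icc.2 hle, rfl⟩,
      Set.mem_iUnion.2 ⟨⟨i, le_rfl⟩, Metric.mem_ball_self hs0⟩⟩
    ⟨J (t j), ⟨_, Set.right_mem_Icc.2 hle, rfl⟩,
      Set.mem_iUnion.2 ⟨⟨j, le_rfl⟩, Metric.mem_ball_self hs0⟩⟩
  obtain ⟨_, ⟨u, hu, rfl⟩, hU, hV⟩ := key
  obtain ⟨⟨k, hk⟩, hku⟩ := Set.mem_iUnion.1 hU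
  obtain ⟨⟨l, hl⟩, hlu⟩ := Set.mem_iUnion.1 hV
  have near : ∀ m : Fin N, dist (J u) (J (t m)) < s →
      ∀ x ∈ Set.Icc (min u (t m)) (max u (t m)), dist (J x) (J u) ≤ δ / 4 := by
    intro m hm x hx
    have h1 := hqa u (hsub hu) (t m) (htm m) (hm.le.trans hsδ)
    have h2 : dist (J x) (J u) ≤ Metric.diam (J '' Set.Icc (min u (t m)) (max u (t m))) :=
      Metric.dist_le_diam_of_mem
        (hbdd _ _ (le_min (hsub hu).1 (htm m).1) (max_le (hsub hu).2 (htm m).2))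
        ⟨x, hx, rfl⟩ ⟨u, ⟨min_le_left _ _, le_max_left _ _⟩, rfl⟩
    have h3 : lam * dist (J u) (J (t m)) ≤ lam * s := by gcongr
    linarith
  have all : ∀ x ∈ Set.Icc (t i) (t j), dist (J x) (J u) ≤ δ / 4 := by
    intro x hx
    rcases le_total x u with h | h
    · exact near k hku x ⟨(min_le_right _ _).trans ((hmono.monotone hk).trans hx.1),
        h.trans (le_max_left _ _)⟩
    · exact near l hlu x ⟨(min_le_left _ _).trans h,
        (hx.2.trans (hmono.monotone hl)).trans (le_max_right _ _)⟩
  have hD : Metric.diam (J '' Set.Icc (t i) (t j)) ≤ δ / 2 := by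
    apply Metric.diam_le_of_forall_dist_le (by linarith)
    rintro _ ⟨x, hx, rfl⟩ _ ⟨y, hy, rfl⟩
    have := dist_triangle_right (J x) (J y) (J u)
    linarith [all x hx, all y hy]
  exact ⟨hsd.trans hd, hD, hsd, hd.trans hD⟩
end
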